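/- Let K be a field, G a finite subgroup of PGL₂(K) with quotient map Q_G, and F ∈ K[x] monic irreducible such that all roots of F^{Q_G} lie in regular G-orbits. Then every monic irreducible factor r of F^{Q_G} satisfies deg(r) = (|G|/|G∗r|) · deg(F), where G∗r is the orbit of r under the polynomial action of G; moreover if deg(F) < deg(r) then the stabilizer of r in G is nontrivial. -/

import Mathlib

open Polynomial

attribute [local instance] Classical.propDecidable

noncomputable section

variable (K : Type*) [Field K]

/-- The projective general linear group `PGL₂(K)`. -/
abbrev PGL2 := Matrix.GeneralLinearGroup (Fin 2) K ⧸
  Subgroup.center (Matrix.GeneralLinearGroup (Fin 2) K)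

variable {K}

/-- entry of a matrix in `GL₂(K)` -/
def ent (A : Matrix.GeneralLinearGroup (Fin 2) K) (i j : Fin 2) : K :=
  (A : Matrix (Fin 2) (Fin 2) K) i j

/-- `(cx+d)^n · p((ax+b)/(cx+d))`, the raw (un-normalized) transform. -/
def rawAct (A : Matrix.GeneralLinearGroup (Fin 2) K) (n : ℕ) (p : Polynomial K) :
    Polynomial K :=
  ∑ i ∈ Finset.range (n + 1),
    C (p.coeff i) * (C (ent A 0 0) * X + C (ent A 0 1)) ^ i *
      (C (ent A 1 0) * X + C (ent A 1 1)) ^ (n - i)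

/-- The normalized polynomial transformation `[A]∗f`. -/
def polyAct (A : Matrix.GeneralLinearGroup (Fin 2) K) (f : Polynomial K) : Polynomial K :=
  rawAct A f.natDegree f * C (rawAct A f.natDegree f).leadingCoeff⁻¹

/-- Möbius action of `GL₂(K)` on `K̄ ∪ {∞}`; `none` plays the role of `∞`. -/
def mob (A : Matrix.GeneralLinearGroup (Fin 2) K) :
    Option (AlgebraicClosure K) → Option (AlgebraicClosure K)
  | none =>
      if algebraMap K (AlgebraicClosure K) (ent A 1 0) = 0 then none
      else some (algebraMap K (AlgebraicClosure K) (ent A 0 0) /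
        algebraMap K (AlgebraicClosure K) (ent A 1 0))
  | some x =>
      if algebraMap K (AlgebraicClosure K) (ent A 1 0) * x +
          algebraMap K (AlgebraicClosure K) (ent A 1 1) = 0 then none
      else some ((algebraMap K (AlgebraicClosure K) (ent A 0 0) * x +
          algebraMap K (AlgebraicClosure K) (ent A 0 1)) /
        (algebraMap K (AlgebraicClosure K) (ent A 1 0) * x +
          algebraMap K (AlgebraicClosure K) (ent A 1 1)))

/-- Möbius orbit of a point under a subgroup `G ≤ PGL₂(K)`. -/
def mobOrbit (G : Subgroup (PGL2 K)) (v : Option (AlgebraicClosure K)) :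
    Set (Option (AlgebraicClosure K)) :=
  {w | ∃ A : Matrix.GeneralLinearGroup (Fin 2) K,
    (QuotientGroup.mk A : PGL2 K) ∈ G ∧ mob A v = w}

/-- Orbit of a polynomial under the normalized action of `G ≤ PGL₂(K)`. -/
def polyOrbit (G : Subgroup (PGL2 K)) (r : Polynomial K) : Set (Polynomial K) :=
  {t | ∃ A : Matrix.GeneralLinearGroup (Fin 2) K,
    (QuotientGroup.mk A : PGL2 K) ∈ G ∧ polyAct A r = t}

/-- `f` has no roots in the Möbius `G`-orbit of `∞`. -/
def NoRootsInOrbitInfty (G : Subgroup (PGL2 K)) (f : Polynomial K) : Prop :=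
  ∀ x : AlgebraicClosure K, some x ∈ mobOrbit G none → Polynomial.aeval x f ≠ 0

/-- `f` is `G`-invariant for the normalized polynomial action. -/
def GInvariant (G : Subgroup (PGL2 K)) (f : Polynomial K) : Prop :=
  ∀ A : Matrix.GeneralLinearGroup (Fin 2) K,
    (QuotientGroup.mk A : PGL2 K) ∈ G → polyAct A f = f

/-- `Q_G = g/h` is a quotient map for the finite subgroup `G ≤ PGL₂(K)`:
a `G`-invariant reduced rational function with `g` monic and
`deg h < deg g = |G|` (equivalently, a normalized generator of `K(x)^G`). -/
structure IsQuotientMap (G : Subgroup (PGL2 K)) (g h : Polynomial K) : Prop where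
  monic_g : g.Monic
  h_ne : h ≠ 0
  coprime : IsCoprime g h
  deg_lt : h.natDegree < g.natDegree
  deg_eq : g.natDegree = Nat.card G
  invariant : ∀ A : Matrix.GeneralLinearGroup (Fin 2) K,
    (QuotientGroup.mk A : PGL2 K) ∈ G →
      rawAct A g.natDegree g * h = rawAct A g.natDegree h * g

/-- The `Q`-transform `F^{g/h}(x) = h(x)^{deg F} F(g(x)/h(x))`. -/
def Qtransform (g h F : Polynomial K) : Polynomial K :=
  ∑ i ∈ Finset.range (F.natDegree + 1), C (F.coeff i) * g ^ i * h ^ (F.natDegree - i)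

/-- set of roots of `f` in the algebraic closure -/
def rootSetAC (f : Polynomial K) : Set (AlgebraicClosure K) :=
  {x | Polynomial.aeval x f = 0}

end

theorem ent_det_ne_zero {K : Type*} [Field K] (A : Matrix.GeneralLinearGroup (Fin 2) K) :
    ent A 0 0 * ent A 1 1 - ent A 0 1 * ent A 1 0 ≠ 0 := by
  have h := (Matrix.GeneralLinearGroup.det A).ne_zero
  rwa [Matrix.GeneralLinearGroup.val_det_apply, Matrix.det_fin_two] at h

theorem map_ent_det_ne_zero {K : Type*} [Field K] (A : Matrix.GeneralLinearGroup (Fin 2) K) :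
    algebraMap K (AlgebraicClosure K) (ent A 0 0) * algebraMap K (AlgebraicClosure K) (ent A 1 1) -
      algebraMap K (AlgebraicClosure K) (ent A 0 1) *
        algebraMap K (AlgebraicClosure K) (ent A 1 0) ≠ 0 := by
  rw [← map_mul, ← map_mul, ← map_sub]
  exact (_root_.map_ne_zero _).2 (ent_det_ne_zero A)

theorem num_ne_zero_of_den_eq_zero {K : Type*} [Field K]
    (A : Matrix.GeneralLinearGroup (Fin 2) K) {x : AlgebraicClosure K}
    (hx : algebraMap K (AlgebraicClosure K) (ent A 1 0) * x +
      algebraMap K (AlgebraicClosure K) (ent A 1 1) = 0) :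
    algebraMap K (AlgebraicClosure K) (ent A 0 0) * x +
      algebraMap K (AlgebraicClosure K) (ent A 0 1) ≠ 0 := fun h0 =>
  map_ent_det_ne_zero A <| by
    linear_combination algebraMap K (AlgebraicClosure K) (ent A 0 0) * hx -
      algebraMap K (AlgebraicClosure K) (ent A 1 0) * h0

theorem mob_some_eq_some_iff {K : Type*} [Field K] (A : Matrix.GeneralLinearGroup (Fin 2) K)
    {x y : AlgebraicClosure K} :
    mob A (some x) = some y ↔
      algebraMap K (AlgebraicClosure K) (ent A 0 0) * x +
          algebraMap K (AlgebraicClosure K) (ent A 0 1) =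
        y * (algebraMap K (AlgebraicClosure K) (ent A 1 0) * x +
          algebraMap K (AlgebraicClosure K) (ent A 1 1)) := by
  by_cases hx : algebraMap K (AlgebraicClosure K) (ent A 1 0) * x +
      algebraMap K (AlgebraicClosure K) (ent A 1 1) = 0
  · simpa [mob, hx] using num_ne_zero_of_den_eq_zero A hx
  · rw [mob, if_neg hx, Option.some_inj, div_eq_iff hx]

theorem den_ne_zero_of_mob_eq_some {K : Type*} [Field K]
    {A : Matrix.GeneralLinearGroup (Fin 2) K} {x y : AlgebraicClosure K}
    (h : mob A (some x) = some y) :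
    algebraMap K (AlgebraicClosure K) (ent A 1 0) * x +
      algebraMap K (AlgebraicClosure K) (ent A 1 1) ≠ 0 := fun hx =>
  num_ne_zero_of_den_eq_zero A hx <| by rw [(mob_some_eq_some_iff A).1 h, hx, mul_zero]

theorem inv_mul_ent {K : Type*} [Field K] (A : Matrix.GeneralLinearGroup (Fin 2) K)
    (i j : Fin 2) :
    ent A⁻¹ i 0 * ent A 0 j + ent A⁻¹ i 1 * ent A 1 j = if i = j then 1 else 0 := by
  have h : ((A⁻¹ * A : Matrix.GeneralLinearGroup (Fin 2) K) : Matrix (Fin 2) (Fin 2) K) i j =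
      if i = j then 1 else 0 := by
    rw [inv_mul_cancel, Units.val_one, Matrix.one_apply]
  rwa [Units.val_mul, Matrix.mul_apply, Fin.sum_univ_two] at h

theorem mob_inv_eq_some {K : Type*} [Field K] {A : Matrix.GeneralLinearGroup (Fin 2) K}
    {x y : AlgebraicClosure K} (h : mob A (some x) = some y) :
    mob A⁻¹ (some y) = some x := by
  have hden := den_ne_zero_of_mob_eq_some h
  rw [mob_some_eq_some_iff] at h ⊢
  have e (i j : Fin 2) := congrArg (algebraMap K (AlgebraicClosure K)) (inv_mul_ent A i j)
  simp only [map_add, map_mul] at e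
  have e00 := e 0 0
  have e01 := e 0 1
  have e10 := e 1 0
  have e11 := e 1 1
  simp only [if_true, map_one, map_zero, zero_ne_one, one_ne_zero, if_false] at e00 e01 e10 e11
  refine mul_left_cancel₀ hden ?_
  linear_combination (x * algebraMap K (AlgebraicClosure K) (ent A⁻¹ 1 0) -
      algebraMap K (AlgebraicClosure K) (ent A⁻¹ 0 0)) * h +
    x * e00 + e01 - x ^ 2 * e10 - x * e11

theorem mob_one_some {K : Type*} [Field K] (x : AlgebraicClosure K) :
    mob (1 : Matrix.GeneralLinearGroup (Fin 2) K) (some x) = some x := by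
  rw [mob_some_eq_some_iff]
  simp [ent]

theorem eq_of_mob_eq_some_of_mk_eq_one {K : Type*} [Field K]
    {A : Matrix.GeneralLinearGroup (Fin 2) K} (hA : (QuotientGroup.mk A : PGL2 K) = 1)
    {x y : AlgebraicClosure K} (h : mob A (some x) = some y) : y = x := by
  rw [QuotientGroup.eq_one_iff,
    Matrix.GeneralLinearGroup.mem_center_iff_val_mem_range_scalar] at hA
  obtain ⟨a, ha⟩ := hA
  have hden := den_ne_zero_of_mob_eq_some h
  rw [mob_some_eq_some_iff] at h
  simp only [ent, ← ha, Matrix.scalar_apply, Matrix.diagonal_apply, Fin.isValue, if_true,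
    zero_ne_one, one_ne_zero, if_false, map_zero, zero_mul, zero_add, add_zero] at h hden
  exact mul_right_cancel₀ hden (by rw [← h, mul_comm])

theorem aeval_rawAct {K : Type*} [Field K] (A : Matrix.GeneralLinearGroup (Fin 2) K) (n : ℕ)
    (p : K[X]) (x : AlgebraicClosure K) :
    aeval x (rawAct A n p) = ∑ i ∈ Finset.range (n + 1),
      algebraMap K (AlgebraicClosure K) (p.coeff i) *
        (algebraMap K (AlgebraicClosure K) (ent A 0 0) * x +
          algebraMap K (AlgebraicClosure K) (ent A 0 1)) ^ i *
        (algebraMap K (AlgebraicClosure K) (ent A 1 0) * x +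
          algebraMap K (AlgebraicClosure K) (ent A 1 1)) ^ (n - i) := by
  simp [rawAct, map_sum]

theorem sum_coeff_mul_pow_mul_pow {K L : Type*} [Field K] [Field L] [Algebra K L]
    {n : ℕ} {p : K[X]} (hp : p.natDegree ≤ n) (y c : L) :
    ∑ i ∈ Finset.range (n + 1), algebraMap K L (p.coeff i) * (y * c) ^ i * c ^ (n - i) =
      c ^ n * aeval y p := by
  rw [aeval_eq_sum_range' (Nat.lt_succ_of_le hp), Finset.mul_sum]
  refine Finset.sum_congr rfl fun i hi => ?_
  have hi' : i + (n - i) = n := Nat.add_sub_cancel' (Nat.lt_succ_iff.1 (Finset.mem_range.1 hi))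
  rw [Algebra.smul_def, mul_pow]
  conv_rhs => rw [← hi', pow_add]
  ring

theorem aeval_rawAct_of_mob_eq_some {K : Type*} [Field K]
    {A : Matrix.GeneralLinearGroup (Fin 2) K} {n : ℕ} {p : K[X]} (hp : p.natDegree ≤ n)
    {x y : AlgebraicClosure K} (h : mob A (some x) = some y) :
    aeval x (rawAct A n p) = (algebraMap K (AlgebraicClosure K) (ent A 1 0) * x +
      algebraMap K (AlgebraicClosure K) (ent A 1 1)) ^ n * aeval y p := by
  rw [aeval_rawAct, (mob_some_eq_some_iff A).1 h, sum_coeff_mul_pow_mul_pow hp]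

theorem aeval_rawAct_of_den_eq_zero {K : Type*} [Field K]
    (A : Matrix.GeneralLinearGroup (Fin 2) K) (n : ℕ) (p : K[X]) {x : AlgebraicClosure K}
    (hx : algebraMap K (AlgebraicClosure K) (ent A 1 0) * x +
      algebraMap K (AlgebraicClosure K) (ent A 1 1) = 0) :
    aeval x (rawAct A n p) = algebraMap K (AlgebraicClosure K) (p.coeff n) *
      (algebraMap K (AlgebraicClosure K) (ent A 0 0) * x +
        algebraMap K (AlgebraicClosure K) (ent A 0 1)) ^ n := by
  rw [aeval_rawAct, hx, Finset.sum_eq_single_of_mem n (Finset.self_mem_range_succ n)]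
  · simp
  · intro i hi hin
    have : n - i ≠ 0 := by have := Finset.mem_range.1 hi; omega
    rw [zero_pow this, mul_zero]

theorem natDegree_rawAct_le {K : Type*} [Field K] (A : Matrix.GeneralLinearGroup (Fin 2) K)
    (n : ℕ) (p : K[X]) : (rawAct A n p).natDegree ≤ n := by
  refine natDegree_sum_le_of_forall_le _ _ fun i hi => ?_
  have h1 : (C (p.coeff i) * (C (ent A 0 0) * X + C (ent A 0 1)) ^ i).natDegree ≤ i := by
    refine (natDegree_C_mul_le _ _).trans ((natDegree_pow_le).trans ?_)
    simpa using Nat.mul_le_mul_left i (natDegree_linear_le (a := ent A 0 0) (b := ent A 0 1))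
  have h2 : ((C (ent A 1 0) * X + C (ent A 1 1)) ^ (n - i)).natDegree ≤ n - i := by
    refine (natDegree_pow_le).trans ?_
    simpa using
      Nat.mul_le_mul_left (n - i) (natDegree_linear_le (a := ent A 1 0) (b := ent A 1 1))
  have := Finset.mem_range.1 hi
  exact natDegree_mul_le.trans (by omega)

theorem rawAct_ne_zero {K : Type*} [Field K] (A : Matrix.GeneralLinearGroup (Fin 2) K)
    {n : ℕ} {p : K[X]} (hp : p.natDegree ≤ n) (hp0 : p ≠ 0) : rawAct A n p ≠ 0 := by
  have hlin : C (algebraMap K (AlgebraicClosure K) (ent A⁻¹ 1 0)) * X +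
      C (algebraMap K (AlgebraicClosure K) (ent A⁻¹ 1 1)) ≠ 0 := by
    intro h0
    have h1 := congrArg (coeff · 1) h0
    have h2 := congrArg (coeff · 0) h0
    simp only [coeff_add, coeff_C_mul, coeff_X_one, coeff_C_succ, coeff_X_zero, coeff_C_zero,
      coeff_zero, mul_one, mul_zero, add_zero, zero_add] at h1 h2
    exact map_ent_det_ne_zero A⁻¹ (by rw [h1, h2]; ring)
  obtain ⟨y, hy⟩ := exists_eval_ne_zero_of_natDegree_lt_card
    (p.map (algebraMap K (AlgebraicClosure K)) * _)
    (mul_ne_zero (Polynomial.map_ne_zero hp0) hlin)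
    (Cardinal.natCast_lt_aleph0.trans_le (Cardinal.aleph0_le_mk _))
  rw [eval_mul, eval_map_algebraMap] at hy
  have hden := right_ne_zero_of_mul hy
  simp only [eval_add, eval_mul, eval_C, eval_X] at hden
  obtain ⟨x, hx⟩ : ∃ x, mob A⁻¹ (some y) = some x := ⟨_, by rw [mob, if_neg hden]⟩
  have hx' := mob_inv_eq_some hx
  rw [inv_inv] at hx'
  intro h0
  have h1 := aeval_rawAct_of_mob_eq_some hp hx'
  rw [h0, map_zero] at h1
  exact mul_ne_zero (pow_ne_zero n (den_ne_zero_of_mob_eq_some hx'))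
    (left_ne_zero_of_mul hy) h1.symm

theorem adjoin_le_of_mob_eq_some {K : Type*} [Field K]
    {A : Matrix.GeneralLinearGroup (Fin 2) K} {x y : AlgebraicClosure K}
    (h : mob A (some x) = some y) :
    IntermediateField.adjoin K {y} ≤ IntermediateField.adjoin K {x} := by
  have hx := IntermediateField.mem_adjoin_simple_self K x
  have hK (a : K) := (IntermediateField.adjoin K {x}).algebraMap_mem a
  rw [IntermediateField.adjoin_simple_le_iff,
    eq_div_of_mul_eq (den_ne_zero_of_mob_eq_some h) ((mob_some_eq_some_iff A).1 h).symm]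
  exact div_mem (add_mem (mul_mem (hK _) hx) (hK _)) (add_mem (mul_mem (hK _) hx) (hK _))

theorem natDegree_minpoly_eq_of_mob_eq_some {K : Type*} [Field K]
    {A : Matrix.GeneralLinearGroup (Fin 2) K} {x y : AlgebraicClosure K}
    (h : mob A (some x) = some y) : (minpoly K x).natDegree = (minpoly K y).natDegree := by
  rw [← IntermediateField.adjoin.finrank (Algebra.IsIntegral.isIntegral x),
    ← IntermediateField.adjoin.finrank (Algebra.IsIntegral.isIntegral y),
    le_antisymm (adjoin_le_of_mob_eq_some h) (adjoin_le_of_mob_eq_some (mob_inv_eq_some h))]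

theorem polyAct_minpoly {K : Type*} [Field K]
    {A : Matrix.GeneralLinearGroup (Fin 2) K} {x y : AlgebraicClosure K}
    (h : mob A (some x) = some y) : polyAct A (minpoly K y) = minpoly K x := by
  have h0 := rawAct_ne_zero A le_rfl (minpoly.ne_zero (Algebra.IsIntegral.isIntegral (R := K) y))
  refine minpoly.unique _ _ (monic_mul_leadingCoeff_inv h0) ?_ fun q hq hqx => ?_
  · rw [polyAct, map_mul, aeval_rawAct_of_mob_eq_some le_rfl h, minpoly.aeval, mul_zero, zero_mul]
  · rw [polyAct, degree_mul_leadingCoeff_inv _ h0]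
    refine le_trans ?_ (minpoly.min K x hq hqx)
    rw [degree_eq_natDegree (minpoly.ne_zero (Algebra.IsIntegral.isIntegral (R := K) x)),
      natDegree_minpoly_eq_of_mob_eq_some h]
    exact degree_le_of_natDegree_le (natDegree_rawAct_le _ _ _)

theorem IsQuotientMap.aeval_ne_zero_of_eq_mul {K L : Type*} [Field K] [Field L] [Algebra K L]
    {G : Subgroup (PGL2 K)} {g h : K[X]} (hQ : IsQuotientMap G g h) {x α : L}
    (hx : aeval x g = α * aeval x h) : aeval x h ≠ 0 := by
  intro h0
  obtain ⟨a, b, hab⟩ := hQ.coprime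
  have := congrArg (aeval x) hab
  simp [hx, h0] at this

theorem IsQuotientMap.exists_mob_eq_some {K : Type*} [Field K]
    {G : Subgroup (PGL2 K)} {g h : K[X]} (hQ : IsQuotientMap G g h) {x : AlgebraicClosure K}
    (hx : aeval x h ≠ 0) {A : Matrix.GeneralLinearGroup (Fin 2) K}
    (hA : (QuotientGroup.mk A : PGL2 K) ∈ G) : ∃ y, mob A (some x) = some y := by
  by_cases hden : algebraMap K (AlgebraicClosure K) (ent A 1 0) * x +
      algebraMap K (AlgebraicClosure K) (ent A 1 1) = 0
  · have hinv := congrArg (aeval x) (hQ.invariant A hA)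
    rw [map_mul, map_mul, aeval_rawAct_of_den_eq_zero A _ _ hden,
      aeval_rawAct_of_den_eq_zero A _ _ hden, coeff_eq_zero_of_natDegree_lt hQ.deg_lt,
      hQ.monic_g.coeff_natDegree, map_one, map_zero, one_mul, zero_mul, zero_mul] at hinv
    exact absurd hinv
      (mul_ne_zero (pow_ne_zero _ (num_ne_zero_of_den_eq_zero A hden)) hx)
  · exact ⟨_, by rw [mob, if_neg hden]⟩

theorem IsQuotientMap.aeval_eq_mul_of_mob_eq_some {K : Type*} [Field K]
    {G : Subgroup (PGL2 K)} {g h : K[X]} (hQ : IsQuotientMap G g h)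
    {A : Matrix.GeneralLinearGroup (Fin 2) K} (hA : (QuotientGroup.mk A : PGL2 K) ∈ G)
    {x y α : AlgebraicClosure K} (hxy : mob A (some x) = some y)
    (hx : aeval x g = α * aeval x h) : aeval y g = α * aeval y h := by
  have hinv := congrArg (aeval x) (hQ.invariant A hA)
  rw [map_mul, map_mul, aeval_rawAct_of_mob_eq_some le_rfl hxy,
    aeval_rawAct_of_mob_eq_some hQ.deg_lt.le hxy, hx] at hinv
  refine mul_left_cancel₀ (mul_ne_zero (pow_ne_zero g.natDegree (den_ne_zero_of_mob_eq_some hxy))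
    (hQ.aeval_ne_zero_of_eq_mul hx)) ?_
  linear_combination hinv

theorem IsQuotientMap.exists_root_of_aeval_Qtransform_eq_zero {K L : Type*} [Field K] [Field L]
    [Algebra K L] {G : Subgroup (PGL2 K)} {g h F : K[X]} (hQ : IsQuotientMap G g h)
    (hF : F.Monic) {x : L} (hx : aeval x (Qtransform g h F) = 0) :
    ∃ α : L, aeval α F = 0 ∧ aeval x g = α * aeval x h := by
  have hsum : aeval x (Qtransform g h F) = ∑ i ∈ Finset.range (F.natDegree + 1),
      algebraMap K L (F.coeff i) * aeval x g ^ i * aeval x h ^ (F.natDegree - i) := by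
    simp [Qtransform, map_sum]
  rw [hx] at hsum
  by_cases h0 : aeval x h = 0
  · rw [h0, Finset.sum_eq_single_of_mem _ (Finset.self_mem_range_succ _), hF.coeff_natDegree,
      map_one, one_mul, Nat.sub_self, pow_zero, mul_one] at hsum
    · have hg : aeval x g = 0 := by_contra fun hg => pow_ne_zero _ hg hsum.symm
      exact absurd h0 (hQ.aeval_ne_zero_of_eq_mul (α := 0) (by rw [hg, zero_mul]))
    · intro i hi hin
      have : F.natDegree - i ≠ 0 := by have := Finset.mem_range.1 hi; omega
      rw [zero_pow this, mul_zero]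
  · refine ⟨aeval x g / aeval x h, ?_, (div_mul_cancel₀ _ h0).symm⟩
    have := sum_coeff_mul_pow_mul_pow (p := F) le_rfl (aeval x g / aeval x h) (aeval x h)
    rw [div_mul_cancel₀ _ h0, ← hsum] at this
    exact (mul_eq_zero.1 this.symm).resolve_left (pow_ne_zero _ h0)

theorem finrank_adjoin_simple_mul_natDegree_minpoly {K L : Type*} [Field K] [Field L]
    [Algebra K L] [Algebra.IsAlgebraic K L] {α w : L} (h : α ∈ IntermediateField.adjoin K {w}) :
    (minpoly (IntermediateField.adjoin K {α}) w).natDegree * (minpoly K α).natDegree =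
      (minpoly K w).natDegree := by
  have hint (x : L) : IsIntegral K x := Algebra.IsIntegral.isIntegral x
  rw [← IntermediateField.adjoin.finrank (hint w), ← IntermediateField.adjoin.finrank (hint α),
    ← IntermediateField.adjoin.finrank (hint w).tower_top, mul_comm, Module.finrank_mul_finrank]
  have : (IntermediateField.adjoin (IntermediateField.adjoin K {α}) {w}).restrictScalars K =
      IntermediateField.adjoin K {w} := by
    rw [IntermediateField.adjoin_simple_adjoin_simple]
    refine le_antisymm (IntermediateField.adjoin_le_iff.2 ?_)
      (IntermediateField.adjoin.mono _ _ _ (by simp))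
    rintro x (rfl | rfl)
    · exact h
    · exact IntermediateField.mem_adjoin_simple_self K _
  rw [← this]
  rfl

theorem card_filter_minpoly_eq_mul_natDegree {K L : Type*} [Field K] [Field L] [Algebra K L]
    [IsAlgClosed L] [Normal K L] {S : Finset L} {g h : K[X]} {α : L} (hg : g.Monic)
    (hdeg : h.natDegree < g.natDegree) (hcard : S.card = g.natDegree)
    (hS : ∀ w ∈ S, aeval w g = α * aeval w h) (hS' : ∀ w ∈ S, aeval w h ≠ 0)
    {w : L} (hw : w ∈ S) :
    (S.filter fun w' => minpoly K w' = minpoly K w).card * (minpoly K α).natDegree =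
      (minpoly K w).natDegree := by
  have : Algebra.IsAlgebraic K L := Normal.toIsAlgebraic
  have hE (p : K[X]) : aeval w p ∈ IntermediateField.adjoin K {w} :=
    IntermediateField.algebra_adjoin_le_adjoin K _ (aeval_mem_adjoin_singleton K w)
  have hα : α ∈ IntermediateField.adjoin K {w} := by
    rw [eq_div_of_mul_eq (hS' w hw) (hS w hw).symm]
    exact div_mem (hE g)
      (hE h)
  rw [← finrank_adjoin_simple_mul_natDegree_minpoly hα]
  congr 1
  set E := IntermediateField.adjoin K {α}
  let a : E := ⟨α, IntermediateField.mem_adjoin_simple_self K α⟩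
  let P : E[X] := g.map (algebraMap K E) - C a * h.map (algebraMap K E)
  have hlt : (C a * h.map (algebraMap K E)).degree < (g.map (algebraMap K E)).degree := by
    refine degree_lt_degree ((natDegree_C_mul_le _ _).trans_lt ?_)
    rwa [natDegree_map, natDegree_map]
  have hPmonic : P.Monic := (hg.map _).sub_of_left hlt
  have hPdeg : P.natDegree = g.natDegree := by
    rw [natDegree_eq_of_degree_eq (degree_sub_eq_left_of_degree_lt hlt), natDegree_map]
  have hPeval (x : L) : aeval x P = aeval x g - α * aeval x h := by
    simp only [P, map_sub, map_mul, aeval_C, aeval_map_algebraMap]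
    rfl
  have hPmap : P.map (algebraMap E L) ≠ 0 := Polynomial.map_ne_zero hPmonic.ne_zero
  have hroots : (P.map (algebraMap E L)).roots = S.val := by
    symm
    refine Multiset.eq_of_le_of_card_le ?_ ?_
    · refine (Multiset.le_iff_subset S.nodup).2 fun x hx => ?_
      rw [mem_roots hPmap, IsRoot, eval_map_algebraMap, hPeval, hS x hx, sub_self]
    · rw [Finset.card_val, hcard, ← hPdeg, ← natDegree_map (algebraMap E L)]
      exact card_roots' _
  have hdvd : minpoly E w ∣ P := minpoly.dvd _ _ (by rw [hPeval, hS w hw, sub_self])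
  have hle : ((minpoly E w).map (algebraMap E L)).roots ≤ S.val :=
    hroots ▸ roots.le_of_dvd hPmap (Polynomial.map_dvd _ hdvd)
  have hmin : minpoly E w ≠ 0 :=
    minpoly.ne_zero (Algebra.IsIntegral.isIntegral (R := K) w).tower_top
  have hfilter : (S.filter fun w' => minpoly K w' = minpoly K w).val =
      ((minpoly E w).map (algebraMap E L)).roots := by
    refine (Multiset.Nodup.ext (Finset.nodup _) (Multiset.nodup_of_le hle S.nodup)).2 fun x => ?_
    rw [mem_roots (Polynomial.map_ne_zero hmin), IsRoot, eval_map_algebraMap, Finset.mem_val,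
      Finset.mem_filter]
    constructor
    · rintro ⟨hxS, hx⟩
      obtain ⟨σ, rfl⟩ := isConjRoot_iff_exists_algEquiv.1 (isConjRoot_def.2 hx)
      have hσα : σ α = α := by
        have h1 := hS _ hxS
        have h2 := congrArg σ (hS w hw)
        have h3 := hS' _ hxS
        rw [map_mul, ← aeval_algHom_apply, ← aeval_algHom_apply] at h2
        exact mul_right_cancel₀ h3 (h2.symm.trans h1)
      have hσE : (σ : L →ₐ[K] L).comp E.val = E.val := by
        refine IntermediateField.algHom_ext_of_eq_adjoin K (S := E) (s := {α}) rfl ?_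
        rintro x rfl
        exact hσα
      have hσE' : (σ : L →+* L).comp (algebraMap E L) = algebraMap E L :=
        congrArg AlgHom.toRingHom hσE
      rw [aeval_def, ← hσE', ← RingHom.coe_coe σ, ← hom_eval₂, ← aeval_def, minpoly.aeval,
        map_zero]
    · intro hx
      have hxS : x ∈ S := Multiset.mem_of_le hle <| by
        rwa [mem_roots (Polynomial.map_ne_zero hmin), IsRoot, eval_map_algebraMap]
      refine ⟨hxS, ?_⟩
      obtain ⟨q, hq⟩ := minpoly.dvd_map_of_isScalarTower K E w
      refine (minpoly.eq_of_irreducible_of_monic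
        (minpoly.irreducible (Algebra.IsIntegral.isIntegral w)) ?_
        (minpoly.monic (Algebra.IsIntegral.isIntegral w))).symm
      rw [← aeval_map_algebraMap E, hq, map_mul, hx, zero_mul]
  rw [Finset.card_def, hfilter, IsAlgClosed.card_roots_eq_natDegree, natDegree_map]

theorem IsQuotientMap.some_image_eq_mobOrbit {K : Type*} [Field K]
    {G : Subgroup (PGL2 K)} {g h : K[X]} (hQ : IsQuotientMap G g h) {v : AlgebraicClosure K}
    (hv : aeval v h ≠ 0) :
    some '' {w | some w ∈ mobOrbit G (some v)} = mobOrbit G (some v) := by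
  refine Set.Subset.antisymm (Set.image_subset_iff.2 fun _ => id) ?_
  rintro _ ⟨A, hA, rfl⟩
  obtain ⟨y, hy⟩ := hQ.exists_mob_eq_some hv hA
  exact ⟨y, ⟨A, hA, hy⟩, hy.symm⟩

theorem inv_mk_mem {K : Type*} [Field K] {G : Subgroup (PGL2 K)}
    {A : Matrix.GeneralLinearGroup (Fin 2) K} (hA : (QuotientGroup.mk A : PGL2 K) ∈ G) :
    (QuotientGroup.mk A⁻¹ : PGL2 K) ∈ G := by
  rw [QuotientGroup.mk_inv]
  exact inv_mem hA

theorem IsQuotientMap.polyOrbit_minpoly {K : Type*} [Field K]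
    {G : Subgroup (PGL2 K)} {g h : K[X]} (hQ : IsQuotientMap G g h) {v : AlgebraicClosure K}
    (hv : aeval v h ≠ 0) :
    polyOrbit G (minpoly K v) = minpoly K '' {w | some w ∈ mobOrbit G (some v)} := by
  ext t
  constructor
  · rintro ⟨A, hA, rfl⟩
    obtain ⟨w, hw⟩ := hQ.exists_mob_eq_some hv (inv_mk_mem hA)
    have hw' := mob_inv_eq_some hw
    rw [inv_inv] at hw'
    exact ⟨w, ⟨A⁻¹, inv_mk_mem hA, hw⟩, (polyAct_minpoly hw').symm⟩
  · rintro ⟨w, ⟨A, hA, hw⟩, rfl⟩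
    exact ⟨A⁻¹, inv_mk_mem hA, polyAct_minpoly (mob_inv_eq_some hw)⟩

theorem factor_degree_of_regular {K : Type*} [Field K] (G : Subgroup (PGL2 K))
    (hGfin : (G : Set (PGL2 K)).Finite) (g h : Polynomial K) (hQ : IsQuotientMap G g h)
    (F : Polynomial K) (hF : F.Monic) (hFirr : Irreducible F)
    (hreg : ∀ v : AlgebraicClosure K, v ∈ rootSetAC (Qtransform g h F) →
      (mobOrbit G (some v)).ncard = Nat.card G)
    (r : Polynomial K) (hr : r.Monic) (hrirr : Irreducible r)
    (hrdvd : r ∣ Qtransform g h F) :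
    r.natDegree * (polyOrbit G r).ncard = Nat.card G * F.natDegree ∧
    (F.natDegree < r.natDegree →
      ∃ A : Matrix.GeneralLinearGroup (Fin 2) K,
        (QuotientGroup.mk A : PGL2 K) ∈ G ∧ (QuotientGroup.mk A : PGL2 K) ≠ 1 ∧
          polyAct A r = r) := by
  obtain ⟨v, hvr⟩ := IsAlgClosed.exists_aeval_eq_zero (AlgebraicClosure K) r hrirr.degree_pos.ne'
  have hvQ : aeval v (Qtransform g h F) = 0 := aeval_eq_zero_of_dvd_aeval_eq_zero hrdvd hvr
  obtain ⟨α, hαF, hvα⟩ := hQ.exists_root_of_aeval_Qtransform_eq_zero hF hvQ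
  obtain rfl : r = minpoly K v := minpoly.eq_of_irreducible_of_monic hrirr hvr hr
  obtain rfl : F = minpoly K α := minpoly.eq_of_irreducible_of_monic hFirr hαF hF
  have hvh := hQ.aeval_ne_zero_of_eq_mul hvα
  have hcard : {w | some w ∈ mobOrbit G (some v)}.ncard = g.natDegree := by
    rw [hQ.deg_eq, ← hreg v hvQ, ← Set.ncard_image_of_injective _ (Option.some_injective _),
      hQ.some_image_eq_mobOrbit hvh]
  have hfin : {w | some w ∈ mobOrbit G (some v)}.Finite :=
    Set.finite_of_ncard_pos (hcard ▸ (Nat.zero_le _).trans_lt hQ.deg_lt)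
  rw [hQ.polyOrbit_minpoly hvh, ← hQ.deg_eq]
  generalize hT : {w | some w ∈ mobOrbit G (some v)} = T at hcard hfin
  lift T to Finset (AlgebraicClosure K) using hfin with S
  rw [Set.ncard_coe_finset] at hcard
  have hmem {w : AlgebraicClosure K} : w ∈ S ↔ some w ∈ mobOrbit G (some v) := by
    rw [← Finset.mem_coe, ← hT, Set.mem_ofPred_eq]
  have hS (w) (hw : w ∈ S) : aeval w g = α * aeval w h := by
    obtain ⟨A, hA, hAw⟩ := hmem.1 hw
    exact hQ.aeval_eq_mul_of_mob_eq_some hA hAw hvα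
  have hdegS (w) (hw : w ∈ S) : (minpoly K w).natDegree = (minpoly K v).natDegree := by
    obtain ⟨A, hA, hAw⟩ := hmem.1 hw
    exact (natDegree_minpoly_eq_of_mob_eq_some hAw).symm
  have hfiber (w) (hw : w ∈ S) :
      (S.filter fun w' => minpoly K w' = minpoly K w).card * (minpoly K α).natDegree =
        (minpoly K v).natDegree := by
    rw [← hdegS w hw]
    exact card_filter_minpoly_eq_mul_natDegree hQ.monic_g hQ.deg_lt hcard hS
      (fun w hw => hQ.aeval_ne_zero_of_eq_mul (hS w hw)) hw
  constructor
  · rw [← Finset.coe_image, Set.ncard_coe_finset, ← hcard,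
      Finset.card_eq_sum_card_image (minpoly K) S, Finset.sum_mul, mul_comm]
    refine (Finset.sum_const_nat fun t ht => ?_).symm
    obtain ⟨w, hw, rfl⟩ := Finset.mem_image.1 ht
    exact hfiber w hw
  · intro hlt
    have hvS : v ∈ S := hmem.2 ⟨1, G.one_mem, mob_one_some v⟩
    have hone : 1 < (S.filter fun w' => minpoly K w' = minpoly K v).card := by
      by_contra! hle
      exact hlt.not_ge ((hfiber v hvS).symm.trans_le ((Nat.mul_le_mul_right _ hle).trans_eq (one_mul _)))
    obtain ⟨w, hw, hwv⟩ := Finset.exists_mem_ne hone v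
    rw [Finset.mem_filter] at hw
    obtain ⟨A, hA, hAw⟩ := hmem.1 hw.1
    refine ⟨A, hA, fun h1 => hwv (eq_of_mob_eq_some_of_mk_eq_one h1 hAw), ?_⟩
    have := polyAct_minpoly hAw
    rwa [hw.2] at this
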